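/- For source masses p_1 ≤ p_2 ≤ … ≤ p_m with m ≥ 2, there exist an optimal decoding tree and an integer k with 2 ≤ k ≤ min(q_n, m) such that all dummy leaves of the tree and the leaves assigned the k smallest masses p_1,…,p_k are siblings, i.e., children of one common parent node. -/

import Mathlib

/-- A multi-channel decoding tree for an `n`-channel system with alphabet sizes `q i`:
leaves carry probability masses and every internal node is assigned a channel class
`i ∈ {1,…,n}`. -/
inductive PTree (n : ℕ) (q : Fin n → ℕ) : Type
  | leaf (mass : ℝ) : PTree n q
  | node (i : Fin n) (children : List (PTree n q)) : PTree n q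

namespace PTree

variable {n : ℕ} {q : Fin n → ℕ}

/-- The list of leaf masses of a decoding tree (in left-to-right order). -/
def leafMasses : PTree n q → List ℝ
  | .leaf x => [x]
  | .node _ cs => (cs.attach.map fun c => leafMasses c.1).flatten
decreasing_by
  simp_wf
  have := List.sizeOf_lt_of_mem c.2
  omega

/-- The total leaf mass of a tree; for a subtree rooted at an internal node this is the
reaching probability `s` of that node. -/
noncomputable def mass (t : PTree n q) : ℝ := t.leafMasses.sum

/-- Well-formedness of a decoding tree: every internal node of class `i` has at least one
and at most `q i` children (its outgoing edges being labeled by distinct symbols of the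
`i`-th alphabet), and all its subtrees are well-formed. -/
inductive WF : PTree n q → Prop
  | leaf (x : ℝ) : WF (.leaf x)
  | node (i : Fin n) (cs : List (PTree n q)) :
      cs ≠ [] → cs.length ≤ q i → (∀ c ∈ cs, WF c) → WF (.node i cs)

/-- The list of pairs (leaf mass, description length of the leaf), where the description
length of a leaf is the sum of `ln (q i)` over its internal-node ancestors of class `i`. -/
noncomputable def leafData : PTree n q → List (ℝ × ℝ)
  | .leaf x => [(x, 0)]
  | .node i cs =>
      ((cs.attach.map fun c => leafData c.1).flatten).map fun pr =>
        (pr.1, pr.2 + Real.log (q i))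
decreasing_by
  simp_wf
  have := List.sizeOf_lt_of_mem c.2
  omega

/-- The expected codeword (description) length of the tree in nats: the expectation of the
leaf description lengths under the leaf masses. -/
noncomputable def expLen (t : PTree n q) : ℝ := (t.leafData.map fun pr => pr.1 * pr.2).sum

/-- The subtree of `t` at a position given by a path of child indices (`none` if the path
does not exist in `t`).  Positions serve as names for the node occurrences of the tree. -/
def subtreeAt : PTree n q → List ℕ → Option (PTree n q)
  | t, [] => some t
  | .leaf _, _ :: _ => none
  | .node _ cs, a :: rest => (cs[a]?).bind fun c => subtreeAt c rest

/-- `IsTreeFor p t`: `t` is a decoding tree for the source with masses `p`, i.e. `t` is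
well-formed and its leaves are assigned the masses `p 1, …, p m` together with some number
`w` of dummy leaves of mass `0`. -/
def IsTreeFor {m : ℕ} (p : Fin m → ℝ) (t : PTree n q) : Prop :=
  t.WF ∧ ∃ w : ℕ, (t.leafMasses : Multiset ℝ) =
    ((List.ofFn p : List ℝ) : Multiset ℝ) + Multiset.replicate w 0

/-- `IsOptimal p t`: `t` is an optimal decoding tree for the source with masses `p`, i.e.
it attains the minimum expected codeword length over all decoding trees for the source
(with any number of dummy leaves). -/
def IsOptimal {m : ℕ} (p : Fin m → ℝ) (t : PTree n q) : Prop :=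
  IsTreeFor p t ∧ ∀ t' : PTree n q, IsTreeFor p t' → t.expLen ≤ t'.expLen

end PTree

namespace PTree

variable {n : ℕ} {q : Fin n → ℕ}

/-- A decoding tree is reduced if each of its internal nodes has at least two children. -/
inductive Reduced : PTree n q → Prop
  | leaf (x : ℝ) : Reduced (.leaf x)
  | node (i : Fin n) (cs : List (PTree n q)) :
      2 ≤ cs.length → cs.length ≤ q i → (∀ c ∈ cs, Reduced c) → Reduced (.node i cs)

lemma Reduced.wf {t : PTree n q} (h : t.Reduced) : t.WF := by
  induction h with
  | leaf x => exact .leaf x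
  | node i cs h2 hle _ ih =>
    refine .node i cs ?_ hle ih
    rintro rfl
    simp at h2

@[simp] lemma leafMasses_leaf (x : ℝ) : (leaf x : PTree n q).leafMasses = [x] := by
  rw [leafMasses]

@[simp] lemma leafMasses_node (i : Fin n) (cs : List (PTree n q)) :
    (node i cs).leafMasses = cs.flatMap leafMasses := by
  rw [leafMasses, List.flatMap]
  simp

@[simp] lemma leafData_leaf (x : ℝ) : (leaf x : PTree n q).leafData = [(x, 0)] := by
  rw [leafData]

lemma leafData_node (i : Fin n) (cs : List (PTree n q)) :
    (node i cs).leafData =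
      (cs.flatMap leafData).map fun pr => (pr.1, pr.2 + Real.log (q i)) := by
  rw [leafData, List.flatMap]
  simp

lemma WF.leafMasses_eq {t : PTree n q} (h : t.WF) :
    t.leafMasses = t.leafData.map Prod.fst := by
  induction h with
  | leaf x => simp
  | node i cs _ _ _ ih =>
    rw [leafMasses_node, leafData_node, List.map_map, List.map_flatMap]
    exact List.flatMap_congr fun c hc => ih c hc

@[simp] lemma expLen_leaf (x : ℝ) : (leaf x : PTree n q).expLen = 0 := by
  simp [expLen]

lemma sum_map_shift (D : List (ℝ × ℝ)) (a : ℝ) :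
    ((D.map fun pr => (pr.1, pr.2 + a)).map fun pr => pr.1 * pr.2).sum =
      (D.map fun pr => pr.1 * pr.2).sum + a * (D.map Prod.fst).sum := by
  induction D with
  | nil => simp
  | cons b D ih =>
    simp only [List.map_cons, List.sum_cons, ih]
    ring

lemma sum_map_mul_of_snd_eq {D : List (ℝ × ℝ)} {d : ℝ} (h : ∀ e ∈ D, e.2 = d) :
    (D.map fun pr => pr.1 * pr.2).sum = d * (D.map Prod.fst).sum := by
  induction D with
  | nil => simp
  | cons e D ih =>
    rw [List.forall_mem_cons] at h
    simp only [List.map_cons, List.sum_cons, ih h.2, h.1]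
    ring

lemma sum_flatMap_leafData (cs : List (PTree n q)) :
    ((cs.flatMap leafData).map fun pr => pr.1 * pr.2).sum = (cs.map expLen).sum := by
  induction cs with
  | nil => simp
  | cons c cs ih => simp [ih, expLen]

lemma expLen_node (i : Fin n) (cs : List (PTree n q)) (h : ∀ c ∈ cs, c.WF) :
    (node i cs).expLen =
      (cs.map expLen).sum + Real.log (q i) * (cs.flatMap leafMasses).sum := by
  have hm : cs.flatMap leafMasses = (cs.flatMap leafData).map Prod.fst := by
    rw [List.map_flatMap]
    exact List.flatMap_congr fun c hc => (h c hc).leafMasses_eq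
  rw [expLen, leafData_node, sum_map_shift, sum_flatMap_leafData, hm]

lemma WF.expLen_nonneg {t : PTree n q} (h : t.WF) (h0 : ∀ x ∈ t.leafMasses, 0 ≤ x) :
    0 ≤ t.expLen := by
  induction h with
  | leaf x => simp
  | node i cs _ _ hcs ih =>
    rw [expLen_node i cs hcs]
    rw [leafMasses_node] at h0
    refine add_nonneg (List.sum_nonneg ?_)
      (mul_nonneg (Real.log_natCast_nonneg _) (List.sum_nonneg h0))
    simp only [List.mem_map, forall_exists_index, and_imp, forall_apply_eq_imp_iff₂]
    exact fun c hc => ih c hc fun x hx => h0 x (List.mem_flatMap.2 ⟨c, hc, hx⟩)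

lemma Reduced.leafMasses_length_pos {t : PTree n q} (h : t.Reduced) :
    0 < t.leafMasses.length := by
  induction h with
  | leaf x => simp
  | node i cs h2 _ _ ih =>
    match cs, h2, ih with
    | c :: cs, _, ih =>
      have := ih c (by simp)
      simp only [leafMasses_node, List.flatMap_cons, List.length_append]
      omega

/-- Deleting the leaves of mass `0` and contracting unary nodes does not increase the
expected length. -/
lemma WF.exists_reduced {t : PTree n q} (h : t.WF) (h0 : ∀ x ∈ t.leafMasses, 0 ≤ x)
    (hne : t.leafMasses.filter (· ≠ 0) ≠ []) :
    ∃ t' : PTree n q, t'.Reduced ∧ t'.leafMasses = t.leafMasses.filter (· ≠ 0) ∧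
      t'.expLen ≤ t.expLen := by
  induction h with
  | leaf x =>
    refine ⟨PTree.leaf x, .leaf x, ?_, le_rfl⟩
    by_cases hx : x = 0
    · simp [hx] at hne
    · simp [hx]
  | node i cs hcs hlen hwf ih =>
    have key : ∃ cs' : List (PTree n q), cs'.length ≤ cs.length ∧ (∀ c ∈ cs', c.Reduced) ∧
        cs'.flatMap leafMasses = (cs.flatMap leafMasses).filter (· ≠ 0) ∧
        (cs'.map expLen).sum ≤ (cs.map expLen).sum := by
      rw [leafMasses_node] at h0
      clear hne hlen hcs
      induction cs with
      | nil => exact ⟨[], by simp⟩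
      | cons c cs ihl =>
        obtain ⟨cs', h1, h2, h3, h4⟩ := ihl (fun d hd => hwf d (by simp [hd]))
          (fun d hd => ih d (by simp [hd])) (fun x hx => h0 x (by
            rw [List.flatMap_cons]
            exact List.mem_append_right _ hx))
        have hc0 : ∀ x ∈ c.leafMasses, 0 ≤ x := fun x hx => h0 x (by simp [hx])
        by_cases hc : c.leafMasses.filter (· ≠ 0) = []
        · refine ⟨cs', by simp; omega, h2, ?_, ?_⟩
          · rw [List.flatMap_cons, List.filter_append, hc, h3, List.nil_append]
          · have := (hwf c (by simp)).expLen_nonneg hc0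
            simp only [List.map_cons, List.sum_cons]
            linarith
        · obtain ⟨c', k1, k2, k3⟩ := ih c (by simp) hc0 hc
          refine ⟨c' :: cs', by simpa using h1, ?_, ?_, ?_⟩
          · simpa using ⟨k1, h2⟩
          · rw [List.flatMap_cons, List.flatMap_cons, List.filter_append, h3, k2]
          · simp only [List.map_cons, List.sum_cons]
            linarith
    obtain ⟨cs', h1, h2, h3, h4⟩ := key
    rw [leafMasses_node] at h0 hne ⊢
    have hlog : 0 ≤ Real.log (q i) := Real.log_natCast_nonneg _
    have hsum : (cs'.flatMap leafMasses).sum = (cs.flatMap leafMasses).sum := by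
      rw [h3]
      generalize cs.flatMap leafMasses = L
      induction L with
      | nil => simp
      | cons a L ih => by_cases ha : a = 0 <;> simp_all
    rw [expLen_node i cs hwf]
    match cs', h1, h2, h3, h4, hsum with
    | [], _, _, h3, _, _ => exact absurd h3.symm hne
    | [c], _, h2, h3, h4, _ =>
      refine ⟨c, h2 c (by simp), by simpa using h3, ?_⟩
      have := mul_nonneg hlog (List.sum_nonneg h0)
      simp only [List.map_cons, List.map_nil, List.sum_cons, List.sum_nil, add_zero] at h4
      linarith
    | c :: d :: cs', h1, h2, h3, h4, hsum =>
      refine ⟨PTree.node i (c :: d :: cs'), .node _ _ (by simp) (h1.trans hlen) h2, ?_, ?_⟩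
      · rw [leafMasses_node, h3]
      · rw [expLen_node _ _ fun c hc => (h2 c hc).wf, hsum]
        linarith

lemma finite_lists_of_finite {α : Type*} {s : Set α} (hs : s.Finite) (N : ℕ) :
    {l : List α | l.length ≤ N ∧ ∀ a ∈ l, a ∈ s}.Finite := by
  have := hs.to_subtype
  refine ((List.finite_length_le s N).image (List.map Subtype.val)).subset ?_
  rintro l ⟨hl, hls⟩
  lift l to List s using hls
  exact ⟨l, by simpa using hl, rfl⟩

lemma finite_reduced {S : Set ℝ} (hS : S.Finite) (N : ℕ) :
    {t : PTree n q | t.Reduced ∧ t.leafMasses.length ≤ N ∧ ∀ x ∈ t.leafMasses, x ∈ S}.Finite := by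
  induction N with
  | zero =>
    convert Set.finite_empty
    ext t
    simp only [Set.mem_ofPred_eq, Set.mem_empty_iff_false, iff_false, not_and]
    intro h h'
    have := h.leafMasses_length_pos
    omega
  | succ N ih =>
    refine ((hS.image leaf).union (Set.finite_iUnion fun i : Fin n =>
      (finite_lists_of_finite ih (q i)).image (node i))).subset ?_
    rintro t ⟨ht, hlen, hmem⟩
    cases ht with
    | leaf x => exact .inl ⟨x, hmem x (by simp), rfl⟩
    | node i cs h2 hle hred =>
      refine .inr (Set.mem_iUnion.2 ⟨i, cs, ⟨hle, fun c hc => ⟨hred c hc, ?_, ?_⟩⟩, rfl⟩)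
      · obtain ⟨l₁, l₂, rfl⟩ := List.append_of_mem hc
        have hd : ∃ d, d ∈ l₁ ++ l₂ := by
          apply List.exists_mem_of_length_pos
          simp at h2 ⊢
          omega
        obtain ⟨d, hd⟩ := hd
        have hdpos := (hred d (by simp at hd ⊢; tauto)).leafMasses_length_pos
        have hdle : d.leafMasses.length ≤ ((l₁ ++ l₂).flatMap leafMasses).length :=
          (List.sublist_flatten_of_mem (List.mem_map_of_mem hd)).length_le
        simp only [leafMasses_node, List.flatMap_append, List.flatMap_cons,
          List.length_append] at hlen hdle
        omega
      · intro x hx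
        exact hmem x (by rw [leafMasses_node]; exact List.mem_flatMap.2 ⟨c, hc, hx⟩)

lemma exists_reduced_leafMasses_eq (i : Fin n) (hq : 2 ≤ q i) (L : List ℝ) (hL : L ≠ []) :
    ∃ t : PTree n q, t.Reduced ∧ t.leafMasses = L := by
  induction L with
  | nil => exact absurd rfl hL
  | cons x L ih =>
    by_cases h : L = []
    · exact ⟨leaf x, .leaf x, by simp [h]⟩
    · obtain ⟨t, ht, rfl⟩ := ih h
      refine ⟨node i [leaf x, t], .node _ _ (by simp) (by simpa using hq) ?_, by simp⟩
      simpa using ⟨.leaf x, ht⟩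

/-- An optimal decoding tree can be chosen reduced and without dummy leaves. -/
lemma exists_optimal_reduced (i : Fin n) (hq : 2 ≤ q i) {m : ℕ} (hm : 0 < m) (p : Fin m → ℝ)
    (hp : ∀ j, 0 < p j) :
    ∃ t : PTree n q, t.Reduced ∧ t.leafMasses.Perm (List.ofFn p) ∧ IsOptimal p t := by
  have hne : List.ofFn p ≠ [] := by
    rw [Ne, List.ofFn_eq_nil_iff]
    omega
  have hfin : {t : PTree n q | t.Reduced ∧ t.leafMasses.Perm (List.ofFn p)}.Finite := by
    refine (finite_reduced (Set.finite_range p) m).subset ?_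
    rintro t ⟨ht, hperm⟩
    refine ⟨ht, by simp [hperm.length_eq], fun x hx => ?_⟩
    simpa [List.mem_ofFn] using hperm.mem_iff.1 hx
  obtain ⟨t₀, ht₀, hL⟩ := exists_reduced_leafMasses_eq i hq _ hne
  obtain ⟨t, ⟨ht, hperm⟩, hmin⟩ := Set.exists_min_image _ expLen hfin ⟨t₀, ht₀, by rw [hL]⟩
  refine ⟨t, ht, hperm, ⟨ht.wf, 0, by simpa using hperm⟩, ?_⟩
  rintro t' ⟨hwf, w, hw⟩
  have hw' : t'.leafMasses.Perm (List.ofFn p ++ List.replicate w 0) := by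
    rw [← Multiset.coe_eq_coe, hw, ← Multiset.coe_add, Multiset.coe_replicate]
  have hfilter : (t'.leafMasses.filter (· ≠ 0)).Perm (List.ofFn p) := by
    refine (hw'.filter _).trans (List.Perm.of_eq ?_)
    rw [List.filter_append, List.filter_eq_self.2, List.filter_eq_nil_iff.2, List.append_nil]
    · simp
    · simpa [List.mem_ofFn] using fun j => (hp j).ne'
  obtain ⟨s, hs, hsL, hle⟩ := hwf.exists_reduced
    (fun x hx => by
      have := hw'.mem_iff.1 hx
      rw [List.mem_append, List.mem_ofFn, List.mem_replicate] at this
      rcases this with ⟨j, rfl⟩ | ⟨-, rfl⟩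
      · exact (hp j).le
      · exact le_rfl)
    (fun h => hne (by rw [h] at hfilter; exact hfilter.nil_eq.symm))
  exact (hmin s ⟨hs, hsL ▸ hfilter⟩).trans hle

lemma map_snd_eq_map_shift {D E : List (ℝ × ℝ)} {a : ℝ}
    (h : D.map Prod.snd = (E.map fun pr => (pr.1, pr.2 + a)).map Prod.snd) :
    ∃ D' : List (ℝ × ℝ), D = (D'.map fun pr => (pr.1, pr.2 + a)) ∧
      D'.map Prod.snd = E.map Prod.snd := by
  refine ⟨D.map fun pr => (pr.1, pr.2 - a), by simp [Function.comp_def], ?_⟩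
  have := congrArg (List.map (· - a)) h
  simpa [Function.comp_def] using this

lemma exists_reassign_forest {cs : List (PTree n q)}
    (h : ∀ c ∈ cs, ∀ D : List (ℝ × ℝ), D.map Prod.snd = c.leafData.map Prod.snd →
      ∃ c' : PTree n q, c'.Reduced ∧ c'.leafData = D)
    (D : List (ℝ × ℝ)) (hD : D.map Prod.snd = (cs.flatMap leafData).map Prod.snd) :
    ∃ cs' : List (PTree n q), cs'.length = cs.length ∧ (∀ c ∈ cs', c.Reduced) ∧
      cs'.flatMap leafData = D := by
  induction cs generalizing D with
  | nil => exact ⟨[], by simp_all⟩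
  | cons c cs ih =>
    rw [List.flatMap_cons, List.map_append, List.map_eq_append_iff] at hD
    obtain ⟨D₁, D₂, rfl, h₁, h₂⟩ := hD
    obtain ⟨c', hc', rfl⟩ := h c (by simp) D₁ h₁
    obtain ⟨cs', hlen, hred, rfl⟩ := ih (fun d hd => h d (by simp [hd])) D₂ h₂
    exact ⟨c' :: cs', by simp [hlen], by simpa using ⟨hc', hred⟩, by simp⟩

/-- The leaves of a reduced tree can be assigned arbitrary masses. -/
lemma Reduced.exists_reassign {t : PTree n q} (h : t.Reduced) (D : List (ℝ × ℝ))
    (hD : D.map Prod.snd = t.leafData.map Prod.snd) :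
    ∃ t' : PTree n q, t'.Reduced ∧ t'.leafData = D := by
  induction h generalizing D with
  | leaf x =>
    rw [leafData_leaf, List.map_singleton, List.map_eq_singleton_iff] at hD
    obtain ⟨⟨y, _⟩, rfl, rfl⟩ := hD
    exact ⟨PTree.leaf y, .leaf y, by simp⟩
  | node i cs h2 hle _ ih =>
    rw [leafData_node] at hD
    obtain ⟨D, rfl, hD'⟩ := map_snd_eq_map_shift hD
    obtain ⟨cs', hlen, hred, rfl⟩ := exists_reassign_forest ih D hD'
    exact ⟨PTree.node i cs', .node i cs' (hlen ▸ h2) (hlen ▸ hle) hred, leafData_node i cs'⟩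

lemma leafData_snd_nonneg {t : PTree n q} (h : t.Reduced) :
    ∀ e ∈ t.leafData, 0 ≤ e.2 := by
  induction h with
  | leaf x => simp
  | node i cs _ _ _ ih =>
    simp only [leafData_node, List.mem_map, List.mem_flatMap]
    rintro _ ⟨e, ⟨c, hc, he⟩, rfl⟩
    exact add_nonneg (ih c hc e he) (Real.log_natCast_nonneg _)

lemma Reduced.exists_pos_snd {i : Fin n} {cs : List (PTree n q)} (hq : 2 ≤ q i)
    (h : (PTree.node i cs).Reduced) : ∃ e ∈ (PTree.node i cs).leafData, 0 < e.2 := by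
  have hpos := h.leafMasses_length_pos
  rw [h.wf.leafMasses_eq, List.length_map] at hpos
  obtain ⟨e, he⟩ := List.exists_mem_of_length_pos hpos
  refine ⟨e, he, ?_⟩
  cases h with
  | node _ _ _ _ hred =>
  simp only [leafData_node, List.mem_map, List.mem_flatMap] at he
  obtain ⟨e, ⟨c, hc, he⟩, rfl⟩ := he
  have := leafData_snd_nonneg (hred c hc) e he
  have : 0 < Real.log (q i) := Real.log_pos (by exact_mod_cast hq)
  dsimp only
  linarith

/-- All leaves below some internal node are leaves of maximal description length, and
arbitrary masses can be assigned to them and to the other leaves of the tree. -/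
lemma Reduced.exists_deepest_node (hq : ∀ i, 2 ≤ q i) {t : PTree n q} (h : t.Reduced)
    (hleaf : ∀ x, t ≠ PTree.leaf x) {d : ℝ} (hd : ∃ e ∈ t.leafData, e.2 = d)
    (hmax : ∀ e ∈ t.leafData, e.2 ≤ d) :
    ∃ (pos : List ℕ) (i : Fin n) (k : ℕ) (A B : List ℝ), 2 ≤ k ∧ k ≤ q i ∧
      t.leafData.map Prod.snd = A ++ List.replicate k d ++ B ∧
      ∀ (D E : List (ℝ × ℝ)) (L : List ℝ), D.map Prod.snd = A → E.map Prod.snd = B →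
        L.length = k → ∃ t' : PTree n q, t'.Reduced ∧
          t'.leafData = D ++ L.map (·, d) ++ E ∧
          t'.subtreeAt pos = some (PTree.node i (L.map PTree.leaf)) := by
  induction h generalizing d with
  | leaf x => exact absurd rfl (hleaf x)
  | node i cs h2 hle hred ih =>
    obtain ⟨e₀, he₀, rfl⟩ := hd
    simp only [leafData_node, List.mem_map, List.mem_flatMap] at he₀
    obtain ⟨e, ⟨c, hc, he⟩, rfl⟩ := he₀
    have hmax' : ∀ b ∈ cs, ∀ e' ∈ b.leafData, e'.2 ≤ e.2 := by
      intro b hb e' he'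
      have := hmax (e'.1, e'.2 + Real.log (q i)) (by
        rw [leafData_node]
        exact List.mem_map_of_mem (f := fun pr : ℝ × ℝ => (pr.1, pr.2 + Real.log (q i)))
          (List.mem_flatMap.2 ⟨b, hb, he'⟩))
      simpa using this
    by_cases hcl : ∃ x, c = PTree.leaf x
    · obtain ⟨x, rfl⟩ := hcl
      have he2 : e.2 = 0 := by
        rw [leafData_leaf, List.mem_singleton] at he
        rw [he]
      have hleaves : ∀ b ∈ cs, ∃ y, b = PTree.leaf y := by
        intro b hb
        match b, hb with
        | .leaf y, _ => exact ⟨y, rfl⟩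
        | .node j bs, hb =>
          obtain ⟨e', he', hpos⟩ := (hred _ hb).exists_pos_snd (hq j)
          exact absurd (hmax' _ hb e' he') (by rw [he2]; exact hpos.not_ge)
      have hdata : ∀ L : List ℝ,
          (PTree.node i (L.map (PTree.leaf (q := q)))).leafData = L.map (·, Real.log (q i)) := by
        intro L
        rw [leafData_node]
        induction L with
        | nil => rfl
        | cons y L ih => simpa using ih
      obtain ⟨M, rfl⟩ : ∃ M : List ℝ, cs = M.map PTree.leaf := by
        clear hc hmax hmax' ih hred h2 hle hleaf
        induction cs with
        | nil => exact ⟨[], rfl⟩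
        | cons b cs ih =>
          obtain ⟨y, rfl⟩ := hleaves b (by simp)
          obtain ⟨M, rfl⟩ := ih fun b hb => hleaves b (by simp [hb])
          exact ⟨y :: M, rfl⟩
      refine ⟨[], i, M.length, [], [], by simpa using h2, by simpa using hle, ?_, ?_⟩
      · simp [hdata, he2, Function.comp_def]
      · rintro D E L hD hE hL
        rw [List.map_eq_nil_iff] at hD hE
        subst hD hE
        refine ⟨PTree.node i (L.map PTree.leaf), .node _ _ ?_ ?_ ?_, ?_, ?_⟩
        · simpa [hL] using h2
        · simpa [hL] using hle
        · intro b hb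
          obtain ⟨y, -, rfl⟩ := List.mem_map.1 hb
          exact Reduced.leaf y
        · simp [hdata, he2]
        · rw [subtreeAt]
    · obtain ⟨pos, j, k, A, B, hk2, hkq, hAB, hrel⟩ :=
        ih c hc (fun x hx => hcl ⟨x, hx⟩) ⟨e, he, rfl⟩ (hmax' c hc)
      obtain ⟨cs₁, cs₂, rfl⟩ := List.append_of_mem hc
      refine ⟨cs₁.length :: pos, j, k,
        ((cs₁.flatMap leafData).map Prod.snd ++ A).map (· + Real.log (q i)),
        (B ++ (cs₂.flatMap leafData).map Prod.snd).map (· + Real.log (q i)), hk2, hkq, ?_, ?_⟩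
      · have : ((cs₁ ++ c :: cs₂).flatMap leafData).map Prod.snd =
            (cs₁.flatMap leafData).map Prod.snd ++ (A ++ List.replicate k e.2 ++ B) ++
              (cs₂.flatMap leafData).map Prod.snd := by
          simp [hAB]
        rw [leafData_node, List.map_map]
        trans (((cs₁ ++ c :: cs₂).flatMap leafData).map Prod.snd).map (· + Real.log (q i))
        · rw [List.map_map]
          rfl
        · rw [this]
          simp only [List.map_append, List.map_replicate, List.append_assoc]
      · intro D E L hD hE hL
        have shift : ∀ (D : List (ℝ × ℝ)) (A : List ℝ),
            D.map Prod.snd = A.map (· + Real.log (q i)) →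
            ∃ D' : List (ℝ × ℝ), D = (D'.map fun pr => (pr.1, pr.2 + Real.log (q i))) ∧
              D'.map Prod.snd = A := by
          intro D A h
          obtain ⟨D', rfl, h'⟩ := map_snd_eq_map_shift (D := D) (E := A.map (0, ·))
            (a := Real.log (q i))
            (by simpa [Function.comp_def] using h)
          exact ⟨D', rfl, by simpa [Function.comp_def] using h'⟩
        obtain ⟨D, rfl, hDA⟩ := shift D _ hD
        obtain ⟨E, rfl, hEB⟩ := shift E _ hE
        obtain ⟨D₁, D₂, rfl, hD₁, hD₂⟩ := List.map_eq_append_iff.1 hDA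
        obtain ⟨E₁, E₂, rfl, hE₁, hE₂⟩ := List.map_eq_append_iff.1 hEB
        obtain ⟨c', hc', hdata, hsub⟩ := hrel D₂ E₁ L hD₂ hE₁ hL
        obtain ⟨bs₁, hlen₁, hred₁, rfl⟩ := exists_reassign_forest
          (fun c hc => (hred c (by simp [hc])).exists_reassign) D₁ hD₁
        obtain ⟨bs₂, hlen₂, hred₂, rfl⟩ := exists_reassign_forest
          (fun c hc => (hred c (by simp [hc])).exists_reassign) E₂ hE₂
        refine ⟨PTree.node i (bs₁ ++ c' :: bs₂), .node _ _ ?_ ?_ ?_, ?_, ?_⟩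
        · simpa [hlen₁, hlen₂] using h2
        · simpa [hlen₁, hlen₂] using hle
        · intro b hb
          rw [List.mem_append, List.mem_cons] at hb
          rcases hb with hb | rfl | hb
          exacts [hred₁ b hb, hc', hred₂ b hb]
        · rw [leafData_node]
          simp [hdata, Function.comp_def]
        · rw [subtreeAt, ← hlen₁]
          simpa using hsub

lemma mem_leafMasses_of_subtreeAt {t : PTree n q} {pos : List ℕ} {x : ℝ}
    (h : t.subtreeAt pos = some (leaf x)) : x ∈ t.leafMasses := by
  induction pos generalizing t with
  | nil =>
    rw [subtreeAt, Option.some_inj] at h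
    simp [h]
  | cons a pos ih =>
    match t, h with
    | leaf y, h => simp [subtreeAt] at h
    | node i cs, h =>
      rw [subtreeAt, Option.bind_eq_some_iff] at h
      obtain ⟨c, hc, h⟩ := h
      rw [leafMasses_node]
      exact List.mem_flatMap.2 ⟨c, List.mem_of_getElem? hc, ih h⟩

lemma forall₂_le_trans {L₁ L₂ L₃ : List ℝ} (h₁ : List.Forall₂ (· ≤ ·) L₁ L₂)
    (h₂ : List.Forall₂ (· ≤ ·) L₂ L₃) : List.Forall₂ (· ≤ ·) L₁ L₃ := by
  induction h₁ generalizing L₃ with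
  | nil => exact h₂
  | cons h _ ih =>
    cases h₂ with
    | cons h' h₂ => exact .cons (h.trans h') (ih h₂)

/-- If `M` consists of `M.length` elements of a sorted list, then the remaining elements are
dominated by the elements left over when the `M.length` smallest ones are removed. -/
lemma exists_perm_drop_forall₂_le {P M N : List ℝ} (hP : P.Pairwise (· ≤ ·))
    (h : P.Perm (M ++ N)) :
    ∃ N' : List ℝ, N'.Perm (P.drop M.length) ∧ List.Forall₂ (· ≤ ·) N N' := by
  induction P generalizing M N with
  | nil =>
    obtain ⟨rfl, rfl⟩ := List.append_eq_nil_iff.1 h.nil_eq.symm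
    exact ⟨[], by simp⟩
  | cons x P ih =>
    match M, h with
    | [], h => exact ⟨N, by simpa using h.symm, List.forall₂_refl N⟩
    | y :: M, h =>
      obtain ⟨hx, hP⟩ := List.pairwise_cons.1 hP
      have hxM : x ∈ y :: M ∨ x ∈ N :=
        List.mem_append.1 (h.mem_iff.1 List.mem_cons_self)
      have hxy : x ≤ y := by
        have : y ∈ x :: P := h.mem_iff.2 (by simp)
        rcases List.mem_cons.1 this with rfl | hy
        exacts [le_rfl, hx y hy]
      by_cases hmem : x ∈ y :: M
      · have hperm := List.perm_cons_erase hmem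
        have hlen : ((y :: M).erase x).length = M.length := by
          simpa using hperm.length_eq.symm
        have := ih (M := (y :: M).erase x) (N := N) hP
          (List.Perm.cons_inv (a := x) (h.trans (hperm.append_right N)))
        rw [hlen] at this
        simpa using this
      · obtain ⟨N₁, N₂, rfl⟩ := List.append_of_mem (hxM.resolve_left hmem)
        have : (x :: P).Perm (x :: (M ++ (N₁ ++ y :: N₂))) := by
          refine h.trans ?_
          rw [List.perm_iff_count]
          intro z
          simp only [List.count_append, List.count_cons]
          omega
        obtain ⟨N', hN', hle⟩ := ih hP (List.Perm.cons_inv this)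
        refine ⟨N', by simpa using hN', ?_⟩
        refine forall₂_le_trans ?_ hle
        exact List.rel_append (List.forall₂_refl N₁) (.cons hxy (List.forall₂_refl N₂))

/-- Increasing the masses of leaves whose description length is at most `d` increases the
expected length by at most `d` times the added mass. -/
lemma exists_reweight {D : List (ℝ × ℝ)} {N : List ℝ} {d : ℝ}
    (hN : List.Forall₂ (· ≤ ·) (D.map Prod.fst) N) (hd : ∀ e ∈ D, e.2 ≤ d) :
    ∃ E : List (ℝ × ℝ), E.map Prod.fst = N ∧ E.map Prod.snd = D.map Prod.snd ∧
      (E.map fun pr => pr.1 * pr.2).sum + d * (D.map Prod.fst).sum ≤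
        (D.map fun pr => pr.1 * pr.2).sum + d * N.sum := by
  induction D generalizing N with
  | nil =>
    rw [List.map_nil, List.forall₂_nil_left_iff] at hN
    exact ⟨[], by simp [hN]⟩
  | cons e D ih =>
    rw [List.map_cons, List.forall₂_cons_left_iff] at hN
    obtain ⟨y, N, hey, hN, rfl⟩ := hN
    obtain ⟨E, rfl, hE, hle⟩ := ih hN fun e he => hd e (by simp [he])
    refine ⟨(y, e.2) :: E, by simp, by simp [hE], ?_⟩
    have := mul_nonneg (sub_nonneg.2 hey) (sub_nonneg.2 (hd e (by simp)))
    simp only [List.map_cons, List.sum_cons]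
    nlinarith

end PTree

/-- There exist an optimal decoding tree and an integer `k` with `2 ≤ k ≤ min (q n) m` such
that all dummy leaves of the tree and the leaves assigned the `k` smallest source masses
`p 1, …, p k` are siblings, i.e. children of one common parent node. -/
theorem exists_optimal_tree_smallest_masses_and_dummies_siblings (n : ℕ) (hn : 0 < n)
    (q : Fin n → ℕ) (hq : ∀ i, 2 ≤ q i) (hmono : Monotone q)
    (m : ℕ) (hm : 2 ≤ m) (p : Fin m → ℝ) (hmp : Monotone p) (hp : ∀ j, 0 < p j)
    (hsum : ∑ j, p j = 1) :
    ∃ (t : PTree n q) (k : ℕ) (_ : 2 ≤ k)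
      (hk : k ≤ min (q ⟨n - 1, Nat.sub_lt hn Nat.one_pos⟩) m),
      PTree.IsOptimal p t ∧
      ∃ (pos : List ℕ) (i : Fin n) (cs : List (PTree n q)),
        t.subtreeAt pos = some (.node i cs) ∧
        ((List.ofFn fun j : Fin k =>
            PTree.leaf (q := q) (p (Fin.castLE (hk.trans (min_le_right _ _)) j))
          : List (PTree n q)) : Multiset (PTree n q)) ≤ (cs : Multiset (PTree n q)) ∧
        (∀ pos' : List ℕ, t.subtreeAt pos' = some (.leaf 0) →
          ∃ a : ℕ, pos' = pos ++ [a]) := by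
  obtain ⟨t, ht, hperm, hopt⟩ :=
    PTree.exists_optimal_reduced ⟨0, hn⟩ (hq _) (by omega) p hp
  have hleaf : ∀ x, t ≠ .leaf x := by
    rintro x rfl
    have := hperm.length_eq
    simp at this
    omega
  have hlen : t.leafData.length = m := by
    simpa [ht.wf.leafMasses_eq] using hperm.length_eq
  obtain ⟨d, hd, hmax⟩ : ∃ d, (∃ e ∈ t.leafData, e.2 = d) ∧ ∀ e ∈ t.leafData, e.2 ≤ d := by
    obtain ⟨e₀, he₀, hmax⟩ := t.leafData.toFinset.exists_max_image Prod.snd (by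
      rw [List.toFinset_nonempty_iff]
      rintro h
      simp [h] at hlen
      omega)
    exact ⟨e₀.2, ⟨e₀, by simpa using he₀, rfl⟩, by simpa using hmax⟩
  obtain ⟨pos, i, k, A, B, hk2, hkq, hAB, hrel⟩ :=
    ht.exists_deepest_node hq hleaf hd hmax
  obtain ⟨DM, E, hdata, hDM, hE⟩ := List.map_eq_append_iff.1 hAB
  obtain ⟨D, M, rfl, hD, hM⟩ := List.map_eq_append_iff.1 hDM
  have hMk : M.length = k := by simpa using congrArg List.length hM
  have hkm : k ≤ m := by
    rw [← hlen, hdata, ← hMk]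
    simp only [List.length_append]
    omega
  have hsorted : (List.ofFn p).Pairwise (· ≤ ·) :=
    List.pairwise_ofFn.2 fun a b hab => hmp hab.le
  have hMN : (List.ofFn p).Perm (M.map Prod.fst ++ (D ++ E).map Prod.fst) := by
    refine hperm.symm.trans ?_
    rw [ht.wf.leafMasses_eq, hdata, ← List.map_append, ← List.append_assoc]
    exact (List.perm_append_comm.append_right E).map _
  obtain ⟨N, hN, hle⟩ := PTree.exists_perm_drop_forall₂_le hsorted hMN
  rw [List.length_map, hMk] at hN
  obtain ⟨F, rfl, hF, hcost⟩ := PTree.exists_reweight (d := d) hle fun e he => hmax e (by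
    simp only [hdata, List.mem_append] at he ⊢
    tauto)
  rw [List.map_append, hD, hE] at hF
  obtain ⟨D', E', rfl, hD', hE'⟩ := List.map_eq_append_iff.1 hF
  obtain ⟨t', ht', hdata', hsub⟩ := hrel D' E' ((List.ofFn p).take k) hD' hE' (by simpa using hkm)
  have hperm' : t'.leafMasses.Perm (List.ofFn p) := by
    rw [ht'.wf.leafMasses_eq, hdata']
    have h1 : ((List.ofFn p).take k ++ (D' ++ E').map Prod.fst).Perm (List.ofFn p) := by
      conv_rhs => rw [← List.take_append_drop k (List.ofFn p)]
      exact hN.append_left _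
    refine List.Perm.trans ?_ h1
    simp only [List.map_append, List.map_map, Function.comp_def, List.map_id',
      ← List.append_assoc]
    exact List.perm_append_comm.append_right _
  have hfor : PTree.IsTreeFor p t' := ⟨ht'.wf, 0, by simpa using hperm'⟩
  have hle' : t'.expLen ≤ t.expLen := by
    have hMc := PTree.sum_map_mul_of_snd_eq fun e he =>
      (List.map_eq_replicate_iff.1 (hMk ▸ hM)) e he
    have hLc := PTree.sum_map_mul_of_snd_eq (D := ((List.ofFn p).take k).map (·, d)) (d := d)
      (by simp only [List.mem_map]; rintro _ ⟨x, -, rfl⟩; rfl)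
    simp only [List.map_map, Function.comp_def, List.map_id'] at hLc
    have hs1 := hMN.sum_eq
    have hs2 : ((List.ofFn p).take k).sum + ((List.ofFn p).drop k).sum = (List.ofFn p).sum := by
      rw [← List.sum_append, List.take_append_drop]
    rw [hN.sum_eq] at hcost
    rw [PTree.expLen, PTree.expLen, hdata, hdata']
    simp only [List.map_append, List.sum_append, List.map_map, Function.comp_def, hLc,
      hMc] at hcost hs1 ⊢
    have := congrArg (d * ·) (hs2.trans hs1)
    simp only [mul_add] at this hcost
    linarith
  refine ⟨t', k, hk2, le_min (hkq.trans (hmono ?_)) hkm,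
    ⟨hfor, fun s hs => hle'.trans (hopt.2 s hs)⟩,
    pos, i, _, hsub, ?_, ?_⟩
  · exact Fin.mk_le_mk.2 (by omega)
  · refine le_of_eq (congrArg _ ?_)
    rw [← Fin.ofFn_take_eq_take_ofFn hkm, List.map_ofFn]
    rfl
  · intro pos' hpos'
    have h0 := hperm'.mem_iff.1 (PTree.mem_leafMasses_of_subtreeAt hpos')
    obtain ⟨j, hj⟩ := List.mem_ofFn.1 h0
    exact absurd hj (hp j).ne'
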